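/- arXiv:0906.2763 — 2 statements merged into one kernel-verified Lean document; each statement's English description precedes it below -/
import Mathlib

section
/- For every α ∈ ℕ and all μ, ν ∈ ℝ with μ, ν > 0 and μ ≠ ν, the contour integral over the vertical line Re z = 1 (traversed upwards) satisfies (1/(2πi)) ∫_{1−i∞}^{1+i∞} exp( z/4 − (μ+ν)/z ) · I_α( 2√(μν)/z ) / z² dz = ( J_α(√μ) √ν J_α'(√ν) − √μ J_α'(√μ) J_α(√ν) ) / (2(μ−ν)). -/
open MeasureTheory

noncomputable section

/-- The Bessel function of the first kind of integer order `α`,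
`J_α(x) = ∑_k (−1)^k / (k! (k+α)!) · (x/2)^(2k+α)`. -/
def besselJ (α : ℕ) (x : ℝ) : ℝ :=
  ∑' k : ℕ, (-1 : ℝ) ^ k / ((k.factorial : ℝ) * ((k + α).factorial : ℝ)) * (x / 2) ^ (2 * k + α)

/-- The modified Bessel function of the first kind of integer order `α`,
`I_α(z) = ∑_k 1 / (k! (k+α)!) · (z/2)^(2k+α)`. -/
def besselI (α : ℕ) (z : ℂ) : ℂ :=
  ∑' k : ℕ, 1 / ((k.factorial : ℂ) * ((k + α).factorial : ℂ)) * (z / 2) ^ (2 * k + α)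


theorem lap_int (n : ℕ) (w : ℝ) :
    IntegrableOn (fun x : ℝ => (x:ℂ) ^ n * Complex.exp (-(1 + w * Complex.I) * x)) (Set.Ioi 0) := by
  have h := integrableOn_rpow_mul_exp_neg_mul_rpow (p := 1) (s := n) (b := 1)
    (by have : (0:ℝ) ≤ n := Nat.cast_nonneg n
        linarith) one_pos one_pos
  refine Integrable.mono' h ?_ ?_
  · exact Continuous.aestronglyMeasurable (by fun_prop)
  · refine (ae_restrict_iff' measurableSet_Ioi).2 (Filter.Eventually.of_forall fun x hx => ?_)
    have hx' : 0 < x := hx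
    rw [norm_mul, norm_pow, Complex.norm_exp, Complex.norm_real, Real.norm_of_nonneg hx'.le]
    simp

theorem lap (n : ℕ) (w : ℝ) :
    ∫ x in Set.Ioi (0:ℝ), (x:ℂ) ^ n * Complex.exp (-(1 + w * Complex.I) * x)
      = n.factorial / (1 + w * Complex.I) ^ (n + 1) := by
  have hc : (1 + w * Complex.I) ≠ 0 := by
    intro h
    have := congrArg Complex.re h
    simp at this
  induction n with
  | zero =>
    have := integral_exp_mul_complex_Ioi (a := -(1 + w * Complex.I)) (by simp) 0
    simp only [pow_zero, one_mul]
    rw [this, neg_div_neg_eq]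
    simp
  | succ n ih =>
    set c := 1 + w * Complex.I with hcdef
    have key := integral_Ioi_of_hasDerivAt_of_tendsto' (a := (0:ℝ)) (m := (0:ℂ))
      (f := fun x : ℝ => (x:ℂ) ^ (n+1) * Complex.exp (-c * x))
      (f' := fun x : ℝ => ((n:ℂ)+1) * ((x:ℂ) ^ n * Complex.exp (-c * x))
         - c * ((x:ℂ) ^ (n+1) * Complex.exp (-c * x))) ?_ ?_ ?_
    · rw [integral_sub ((lap_int n w).const_mul _) ((lap_int (n+1) w).const_mul _),
        integral_const_mul, integral_const_mul, ih] at key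
      rw [zero_sub, Complex.ofReal_zero, zero_pow (Nat.succ_ne_zero n), zero_mul, neg_zero,
        sub_eq_zero] at key
      rw [eq_div_iff (by positivity)]
      rw [pow_succ c (n+1), ← mul_assoc, mul_right_comm, mul_comm _ c]
      rw [← key, Nat.factorial_succ]
      push_cast
      field_simp
    · intro x _
      have h1 : HasDerivAt (fun x : ℝ => (x:ℂ)) 1 x := Complex.ofRealCLM.hasDerivAt
      have := (h1.pow (n+1)).mul ((h1.const_mul (-c)).cexp)
      refine this.congr_deriv ?_
      have hp : ((fun x : ℝ => (x:ℂ)) ^ (n+1)) x = (x:ℂ) ^ (n+1) := rfl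
      rw [hp]
      push_cast
      ring
    · exact ((lap_int n w).const_mul _).sub ((lap_int (n+1) w).const_mul _)
    · rw [tendsto_zero_iff_norm_tendsto_zero]
      refine (Real.tendsto_pow_mul_exp_neg_atTop_nhds_zero (n+1)).congr' ?_
      filter_upwards [Filter.eventually_gt_atTop 0] with x hx'
      rw [norm_mul, norm_pow, Complex.norm_exp, Complex.norm_real, Real.norm_of_nonneg hx'.le]
      simp [hcdef]

theorem normsq_z (t : ℝ) : ‖(1 + (t:ℂ) * Complex.I)‖ ^ 2 = 1 + t ^ 2 := by
  rw [Complex.sq_norm, Complex.normSq_apply]; simp; ring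

theorem z_ne (t : ℝ) : (1 + (t:ℂ) * Complex.I) ≠ 0 := by
  intro h
  have := congrArg Complex.re h
  simp at this

theorem one_le_norm_z (t : ℝ) : 1 ≤ ‖(1 + (t:ℂ) * Complex.I)‖ := by
  have := normsq_z t
  nlinarith [norm_nonneg (1 + (t:ℂ) * Complex.I), sq_nonneg t]

theorem norm_inv_z_le (n : ℕ) (t : ℝ) :
    ‖1 / (1 + (t:ℂ) * Complex.I) ^ (n + 2)‖ ≤ (1 + t ^ 2)⁻¹ := by
  rw [norm_div, norm_one, norm_pow, pow_add, normsq_z, one_div]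
  apply inv_anti₀ (by positivity)
  exact le_mul_of_one_le_left (by positivity) (one_le_pow₀ (one_le_norm_z t))

theorem int_inv_z (n : ℕ) : Integrable (fun t : ℝ => 1 / (1 + (t:ℂ) * Complex.I) ^ (n + 2)) := by
  refine Integrable.mono' integrable_inv_one_add_sq ?_ (Filter.Eventually.of_forall (norm_inv_z_le n))
  refine Continuous.aestronglyMeasurable ?_
  refine continuous_const.div (by fun_prop) (fun t => pow_ne_zero _ (z_ne t))

open FourierTransform in
theorem inv_lap (n : ℕ) :
    ∫ t : ℝ, Complex.exp ((1 + (t:ℂ) * Complex.I) / 4) / (1 + (t:ℂ) * Complex.I) ^ (n + 2)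
      = 2 * Real.pi * ((1 / 4) ^ (n + 1) / ((n + 1).factorial : ℂ)) := by
  set g : ℝ → ℂ := (Set.Ioi (0:ℝ)).indicator (fun x : ℝ => (x:ℂ) ^ (n+1) * Complex.exp (-x)) with hg
  have hgi : Integrable g := by
    rw [hg, integrable_indicator_iff measurableSet_Ioi]
    simpa using lap_int (n+1) 0
  have hF : 𝓕 g = fun ξ : ℝ => ((n+1).factorial : ℂ) *
      (1 / (1 + ((2 * Real.pi * ξ : ℝ) : ℂ) * Complex.I) ^ (n + 2)) := by
    ext ξ
    rw [Real.fourier_real_eq_integral_exp_smul]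
    have := lap (n+1) (2 * Real.pi * ξ)
    rw [mul_one_div, ← this, ← integral_indicator measurableSet_Ioi]
    congr 1
    ext x
    rw [hg]
    by_cases hx : x ∈ Set.Ioi (0:ℝ)
    · rw [Set.indicator_of_mem hx, Set.indicator_of_mem hx, smul_eq_mul, mul_left_comm, ← Complex.exp_add]
      congr 2
      push_cast
      ring
    · rw [Set.indicator_of_notMem hx, Set.indicator_of_notMem hx, smul_zero]
  have hFi : Integrable (𝓕 g) := by
    rw [hF]
    exact ((int_inv_z n).comp_mul_left' (R := 2 * Real.pi) (by positivity)).const_mul _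
  have hcont : ContinuousAt g (1/4) := by
    have : g =ᶠ[nhds (1/4)] (fun x : ℝ => (x:ℂ) ^ (n+1) * Complex.exp (-x)) := by
      filter_upwards [Ioi_mem_nhds (show (0:ℝ) < 1/4 by norm_num)] with x hx
      rw [hg, Set.indicator_of_mem (by exact hx)]
    refine ContinuousAt.congr ?_ this.symm
    fun_prop
  have inv := hgi.fourierInv_fourier_eq hFi hcont
  rw [Real.fourierInv_eq', hF] at inv
  have hcv := MeasureTheory.Measure.integral_comp_mul_left (fun t : ℝ => 
    Complex.exp ((t:ℂ) * Complex.I / 4) * (1/ (1 + (t:ℂ) * Complex.I) ^ (n + 2))) (2 * Real.pi)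
  have e1 : ∀ v : ℝ, Complex.exp (((2 * Real.pi * inner ℝ v (1/4) : ℝ) : ℂ) * Complex.I) •
      (((n+1).factorial : ℂ) *
      (1 / (1 + ((2 * Real.pi * v : ℝ) : ℂ) * Complex.I) ^ (n + 2))) = 
      ((n+1).factorial : ℂ) * (Complex.exp (((2 * Real.pi * v : ℝ):ℂ) * Complex.I / 4) * (1/ (1 + ((2 * Real.pi * v : ℝ):ℂ) * Complex.I) ^ (n + 2))) := by
    intro v
    rw [smul_eq_mul, mul_left_comm]
    congr 3
    simp
    ring
  simp_rw [e1] at inv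
  rw [integral_const_mul, hcv, hg, Set.indicator_of_mem (by norm_num)] at inv
  have e2 : ∀ t : ℝ, Complex.exp ((1 + (t:ℂ) * Complex.I) / 4) / (1 + (t:ℂ) * Complex.I) ^ (n + 2)
     = Complex.exp (1/4) * (Complex.exp ((t:ℂ) * Complex.I / 4) * (1/ (1 + (t:ℂ) * Complex.I) ^ (n + 2))) := by
    intro t
    rw [add_div, Complex.exp_add]
    ring
  simp_rw [e2]
  rw [integral_const_mul]
  have hpi : (Real.pi : ℂ) ≠ 0 := by exact_mod_cast Real.pi_ne_zero
  have hf : ((n+1).factorial : ℂ) ≠ 0 := by exact_mod_cast (Nat.factorial_ne_zero _)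
  rw [abs_of_nonneg (by positivity)] at inv
  set X := ∫ (t : ℝ), Complex.exp ((t:ℂ) * Complex.I / 4) * (1 / (1 + (t:ℂ) * Complex.I) ^ (n + 2))
  have hX : X = 2 * Real.pi * ((1/4)^(n+1) * Complex.exp (-(1/4)) / ((n+1).factorial : ℂ)) := by
    rw [Complex.real_smul] at inv
    push_cast at inv
    rw [← inv]
    field_simp
  rw [hX]
  have : Complex.exp (1/4) * Complex.exp (-(1/4)) = 1 := by rw [← Complex.exp_add]; simp
  linear_combination (2 * Real.pi * ((1/4)^(n+1) / ((n+1).factorial : ℂ))) * this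
def uu (α : ℕ) (x : ℝ) (a : ℕ) : ℝ := (-x / 4) ^ a / ((a.factorial : ℝ) * ((a + α).factorial : ℝ))

theorem uu_succ (α : ℕ) (x : ℝ) (a : ℕ) :
    x / 4 * uu α x a = -((a + 1 : ℝ) * (a + 1 + α)) * uu α x (a + 1) := by
  unfold uu
  have h1 : (a.factorial : ℝ) ≠ 0 := by exact_mod_cast (Nat.factorial_ne_zero _)
  have h2 : ((a + α).factorial : ℝ) ≠ 0 := by exact_mod_cast (Nat.factorial_ne_zero _)
  have h3 : (a + 1 + α : ℝ) ≠ 0 := by positivity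
  rw [show a + 1 + α = (a + α) + 1 by ring, Nat.factorial_succ, Nat.factorial_succ]
  push_cast
  rw [show (a + α + 1 : ℝ) = a + 1 + α by ring]
  field_simp
  ring

theorem coef_bound (α a : ℕ) :
    (2 * a + α : ℝ) / ((a.factorial : ℝ) * ((a + α).factorial : ℝ)) ≤ 2 / a.factorial := by
  have h1 : (0:ℝ) < a.factorial := by exact_mod_cast (Nat.factorial_pos _)
  have h2 : (0:ℝ) < (a + α).factorial := by exact_mod_cast (Nat.factorial_pos _)
  have h3 : ((a + α : ℕ) : ℝ) ≤ (a + α).factorial := by exact_mod_cast Nat.self_le_factorial _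
  push_cast at h3
  rw [div_le_div_iff₀ (by positivity) h1]
  have : (0:ℝ) ≤ α := Nat.cast_nonneg _
  nlinarith

theorem coef_bound' (α a : ℕ) :
    1 / ((a.factorial : ℝ) * ((a + α).factorial : ℝ)) ≤ 1 / a.factorial := by
  have h1 : (0:ℝ) < a.factorial := by exact_mod_cast (Nat.factorial_pos _)
  have h3 : (1 : ℝ) ≤ (a + α).factorial := by exact_mod_cast Nat.factorial_pos _
  exact one_div_le_one_div_of_le h1 (by nlinarith)

theorem summable_uu (α : ℕ) (x : ℝ) : Summable fun a => ‖uu α x a‖ := by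
  refine Summable.of_nonneg_of_le (fun _ => norm_nonneg _) (fun a => ?_)
    (Real.summable_pow_div_factorial (‖-x / 4‖))
  unfold uu
  rw [norm_div, norm_pow, Real.norm_of_nonneg (r := _ * _) (by positivity), div_eq_mul_one_div,
    div_eq_mul_one_div (_ ^ a) (a.factorial : ℝ)]
  gcongr ?_ * ?_
  exact coef_bound' α a

theorem summable_uu' (α : ℕ) (x : ℝ) : Summable fun a : ℕ => ‖(2 * a + α : ℝ) * uu α x a‖ := by
  refine Summable.of_nonneg_of_le (fun _ => norm_nonneg _) (fun a => ?_)
    ((Real.summable_pow_div_factorial (‖-x / 4‖)).mul_left 2)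
  unfold uu
  rw [norm_mul, norm_div, norm_pow, Real.norm_of_nonneg (r := _ * _) (by positivity),
    Real.norm_of_nonneg (r := _ + _) (by positivity)]
  have := mul_le_mul_of_nonneg_left (coef_bound α a) (pow_nonneg (norm_nonneg (-x/4)) a)
  refine le_trans (le_of_eq ?_) (this.trans (le_of_eq ?_)) <;> ring

theorem term_eq (α k : ℕ) (x : ℝ) :
    (-1 : ℝ) ^ k / ((k.factorial : ℝ) * ((k + α).factorial : ℝ)) * (x / 2) ^ (2 * k + α)
     = (x / 2) ^ α * uu α (x ^ 2) k := by
  unfold uu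
  rw [pow_add, pow_mul, show -x^2/4 = (-1) * (x/2)^2 by ring, mul_pow]
  ring

theorem besselJ_eq (α : ℕ) (x : ℝ) : besselJ α x = (x / 2) ^ α * ∑' a, uu α (x ^ 2) a := by
  unfold besselJ
  simp_rw [term_eq]
  rw [tsum_mul_left]

theorem besselJ_deriv (α : ℕ) (x : ℝ) (hx : 0 < x) :
    x * deriv (besselJ α) x = (x / 2) ^ α * ∑' a : ℕ, (2 * a + α : ℝ) * uu α (x ^ 2) a := by
  have key := hasDerivAt_tsum_of_isPreconnected
    (g := fun (k : ℕ) (y : ℝ) => (-1 : ℝ) ^ k / ((k.factorial : ℝ) * ((k + α).factorial : ℝ)) * (y / 2) ^ (2 * k + α))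
    (g' := fun (k : ℕ) (y : ℝ) => (-1 : ℝ) ^ k / ((k.factorial : ℝ) * ((k + α).factorial : ℝ)) *
       (((2 * k + α : ℕ) : ℝ) * (y / 2) ^ (2 * k + α - 1) * (1 / 2)))
    (u := fun k : ℕ => x⁻¹ * 2 * ((x ^ α * ‖(2 * k + α : ℝ) * uu α ((2 * x) ^ 2) k‖)))
    (t := Set.Ioo (x / 2) (2 * x)) (y₀ := x) (y := x)
    (((summable_uu' α _).mul_left _).mul_left _) isOpen_Ioo isPreconnected_Ioo ?_ ?_
    ⟨by linarith, by linarith⟩ ?_ ⟨by linarith, by linarith⟩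
  · have h2 : deriv (besselJ α) x = _ := key.deriv
    rw [h2, ← tsum_mul_left, ← tsum_mul_left]
    congr 1
    ext k
    rw [mul_left_comm ((x/2)^α), ← term_eq]
    rcases Nat.eq_zero_or_pos (2 * k + α) with h | h
    · have h' : (2 * k + α : ℝ) = 0 := by exact_mod_cast h
      simp [h, h']
    · obtain ⟨m, hm⟩ := Nat.exists_eq_succ_of_ne_zero h.ne'
      have h' : (2 * k + α : ℝ) = ((2 * k + α : ℕ) : ℝ) := by push_cast; rfl
      rw [h', hm]
      simp only [Nat.succ_sub_one, pow_succ]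
      ring
  · intro k y hy
    refine HasDerivAt.const_mul _ ?_
    have := ((hasDerivAt_id y).div_const 2).pow (2 * k + α)
    exact this
  · intro k y hy
    have hy0 : 0 < y := by linarith [hy.1]
    rcases Nat.eq_zero_or_pos (2 * k + α) with h | h
    · simp only [h]
      simp
      positivity
    · have e : ‖(-1 : ℝ) ^ k / ((k.factorial : ℝ) * ((k + α).factorial : ℝ)) *
       (((2 * k + α : ℕ) : ℝ) * (y / 2) ^ (2 * k + α - 1) * (1 / 2))‖ =
       y⁻¹ * ((2 * k + α : ℝ) / ((k.factorial : ℝ) * ((k + α).factorial : ℝ)) * (y / 2) ^ (2 * k + α)) := by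
        rw [norm_mul, norm_div, norm_pow, norm_neg, norm_one, one_pow,
          Real.norm_of_nonneg (by positivity), Real.norm_of_nonneg (by positivity)]
        obtain ⟨m, hm⟩ := Nat.exists_eq_succ_of_ne_zero h.ne'
        have h' : (2 * k + α : ℝ) = ((2 * k + α : ℕ) : ℝ) := by push_cast; rfl
        rw [h', hm]
        simp only [Nat.succ_sub_one, pow_succ]
        field_simp
      rw [e]
      have e2 : x ^ α * ‖(2 * k + α : ℝ) * uu α ((2 * x) ^ 2) k‖ =
         (2 * k + α : ℝ) / ((k.factorial : ℝ) * ((k + α).factorial : ℝ)) * x ^ (2 * k + α) := by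
        unfold uu
        rw [norm_mul, norm_div, norm_pow, Real.norm_of_nonneg (by positivity),
          Real.norm_of_nonneg (r := _ * _) (by positivity), neg_div, norm_neg,
          Real.norm_of_nonneg (by positivity), pow_add, pow_mul, show (2*x)^2/4 = x^2 by ring]
        ring
      rw [e2]
      have h5 : y⁻¹ ≤ x⁻¹ * 2 := by
        rw [inv_le_iff_one_le_mul₀ hy0]
        have := hy.1
        field_simp
        linarith
      have h6 : (y / 2) ^ (2 * k + α) ≤ x ^ (2 * k + α) := by
        have := hy.2
        gcongr
        linarith
      gcongr
  · simp_rw [term_eq]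
    exact (summable_uu α _).of_norm.mul_left _

theorem summable_T (α : ℕ) (μ ν : ℝ) :
    Summable fun p : ℕ × ℕ => uu α μ p.1 * uu α ν p.2 / (p.1 + p.2 + α + 1) := by
  refine Summable.of_norm_bounded (g := fun p : ℕ × ℕ => ‖uu α μ p.1 * uu α ν p.2‖)
    (summable_mul_of_summable_norm (summable_uu α μ) (summable_uu α ν)).norm ?_
  intro p
  rw [norm_div]
  refine div_le_self (norm_nonneg _) ?_
  rw [Real.norm_of_nonneg (by positivity)]
  have : (0:ℝ) ≤ p.1 + p.2 + α := by positivity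
  linarith

theorem shift1 (α : ℕ) (μ ν : ℝ) : 
    HasSum (fun p : ℕ × ℕ => -((p.1 * (p.1 + α) : ℝ)) * (uu α μ p.1 * uu α ν p.2) / (p.1 + p.2 + α))
      (μ / 4 * ∑' p : ℕ × ℕ, uu α μ p.1 * uu α ν p.2 / (p.1 + p.2 + α + 1)) := by
  have hinj : Function.Injective (fun p : ℕ × ℕ => (p.1 + 1, p.2)) := by
    rintro ⟨a, b⟩ ⟨c, d⟩ h
    simpa using h
  rw [← hinj.hasSum_iff]
  · refine ((summable_T α μ ν).hasSum.mul_left (μ / 4)).congr_fun ?_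
    intro p
    have := uu_succ α μ p.1
    simp only [Function.comp]
    push_cast
    rw [show (p.1 + 1 + p.2 + α : ℝ) = p.1 + p.2 + α + 1 by ring, mul_div_assoc', ← mul_assoc,
      ← mul_assoc, this]
  · rintro ⟨a, b⟩ h
    rcases Nat.eq_zero_or_pos a with rfl | ha
    · simp
    · exact absurd ⟨(a - 1, b), by simp; omega⟩ h

theorem shift2 (α : ℕ) (μ ν : ℝ) : 
    HasSum (fun p : ℕ × ℕ => -((p.2 * (p.2 + α) : ℝ)) * (uu α μ p.1 * uu α ν p.2) / (p.1 + p.2 + α))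
      (ν / 4 * ∑' p : ℕ × ℕ, uu α μ p.1 * uu α ν p.2 / (p.1 + p.2 + α + 1)) := by
  have hinj : Function.Injective (fun p : ℕ × ℕ => (p.1, p.2 + 1)) := by
    rintro ⟨a, b⟩ ⟨c, d⟩ h
    simpa using h
  rw [← hinj.hasSum_iff]
  · refine ((summable_T α μ ν).hasSum.mul_left (ν / 4)).congr_fun ?_
    intro p
    have := uu_succ α ν p.2
    simp only [Function.comp]
    push_cast
    rw [show (p.1 + (p.2 + 1) + α : ℝ) = p.1 + p.2 + α + 1 by ring, mul_div_assoc',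
      mul_left_comm (ν / 4), this]
    ring
  · rintro ⟨a, b⟩ h
    rcases Nat.eq_zero_or_pos b with rfl | ha
    · simp
    · exact absurd ⟨(a, b - 1), by simp; omega⟩ h

theorem hasSum_prod_mul (f g : ℕ → ℝ) (hf : Summable fun a => ‖f a‖)
    (hg : Summable fun a => ‖g a‖) :
    HasSum (fun p : ℕ × ℕ => f p.1 * g p.2) ((∑' a, f a) * ∑' b, g b) := by
  have hs : Summable (fun p : ℕ × ℕ => f p.1 * g p.2) := summable_mul_of_summable_norm hf hg
  have h1 : HasSum f (∑' a, f a) := hf.of_norm.hasSum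
  have h2 : HasSum g (∑' a, g a) := hg.of_norm.hasSum
  exact h1.mul h2 hs

theorem main_series (α : ℕ) (μ ν : ℝ) :
    (μ - ν) / 4 * ∑' p : ℕ × ℕ, uu α μ p.1 * uu α ν p.2 / (p.1 + p.2 + α + 1)
      = ((∑' a, uu α μ a) * (∑' b : ℕ, (2 * b + α : ℝ) * uu α ν b)
        - (∑' a : ℕ, (2 * a + α : ℝ) * uu α μ a) * (∑' b, uu α ν b)) / 2 := by
  have h1 := (shift1 α μ ν).sub (shift2 α μ ν)
  have hA := (summable_uu α μ)
  have hA' := (summable_uu' α μ)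
  have hB := (summable_uu α ν)
  have hB' := (summable_uu' α ν)
  have h2 := hasSum_prod_mul (fun a => uu α μ a) (fun b : ℕ => (2 * b + α : ℝ) * uu α ν b) hA hB'
  have h2' := hasSum_prod_mul (fun a : ℕ => (2 * a + α : ℝ) * uu α μ a) (fun b => uu α ν b) hA' hB
  have h3 := (h2.sub h2').div_const 2
  have e : (μ - ν) / 4 * ∑' p : ℕ × ℕ, uu α μ p.1 * uu α ν p.2 / (p.1 + p.2 + α + 1) =
    μ / 4 * (∑' p : ℕ × ℕ, uu α μ p.1 * uu α ν p.2 / (p.1 + p.2 + α + 1)) -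
    ν / 4 * (∑' p : ℕ × ℕ, uu α μ p.1 * uu α ν p.2 / (p.1 + p.2 + α + 1)) := by ring
  rw [e]
  refine h1.unique ?_
  refine h3.congr_fun ?_
  rintro ⟨a, b⟩
  dsimp only
  by_cases h : (a + b + α : ℝ) = 0
  · have h0 : a + b + α = 0 := by exact_mod_cast h
    have ha : a = 0 := by omega
    have hb : b = 0 := by omega
    subst ha hb
    simp
    ring
  · generalize uu α μ a = U
    generalize uu α ν b = V
    field_simp
    ring

theorem vand (α a b : ℕ) :
    ∑ k ∈ (Finset.range (b + 1)).filter (fun k => k ≤ a),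
      (1:ℝ) / (((a - k).factorial : ℝ) * ((b - k).factorial : ℝ) * (k.factorial : ℝ) * ((k + α).factorial : ℝ))
     = ((a + b + α).factorial : ℝ) / ((a.factorial : ℝ) * (b.factorial : ℝ) * ((a + α).factorial : ℝ) * ((b + α).factorial : ℝ)) := by
  have hf : ∀ n : ℕ, (n.factorial : ℝ) ≠ 0 := fun n => by exact_mod_cast (Nat.factorial_ne_zero n)
  have h := Nat.add_choose_eq a (b + α) b
  rw [Finset.Nat.sum_antidiagonal_eq_sum_range_succ (fun i j => a.choose i * (b + α).choose j)] at h
  have h' := congrArg (fun n : ℕ => (n : ℝ)) h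
  rw [← Finset.sum_filter_of_ne (p := fun k => k ≤ a)] at h'
  · push_cast at h'
    rw [Nat.cast_choose ℝ (by omega : b ≤ a + (b + α)), show a + (b + α) - b = a + α by omega,
      show a + (b + α) = a + b + α by ring] at h'
    have e : ((a + b + α).factorial : ℝ) / ((a.factorial : ℝ) * (b.factorial : ℝ) * ((a + α).factorial : ℝ) * ((b + α).factorial : ℝ))
       = ((a + b + α).factorial : ℝ) / ((b.factorial : ℝ) * ((a + α).factorial : ℝ)) / ((a.factorial : ℝ) * ((b + α).factorial : ℝ)) := by
      field_simp [hf]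
    rw [e, h', Finset.sum_div]
    refine Finset.sum_congr rfl fun k hk => ?_
    simp only [Finset.mem_filter, Finset.mem_range] at hk
    rw [Nat.cast_choose ℝ hk.2, Nat.cast_choose ℝ (by omega : b - k ≤ b + α),
      show b + α - (b - k) = k + α by omega]
    have h1 := hf a
    have h2 := hf (b + α)
    have h3 := hf k
    have h4 := hf (k + α)
    have h5 := hf (a - k)
    have h6 := hf (b - k)
    field_simp
  · intro k _ hk
    by_contra hlt
    apply hk
    rw [Nat.choose_eq_zero_of_lt (by omega)]
    simp

def cc (α : ℕ) (μ ν s : ℝ) (p : ℕ × ℕ × ℕ) : ℝ :=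
  (-μ) ^ p.1 / (p.1.factorial : ℝ) * ((-ν) ^ p.2.1 / (p.2.1.factorial : ℝ) *
    (1 / ((p.2.2.factorial : ℝ) * ((p.2.2 + α).factorial : ℝ)) * s ^ (2 * p.2.2 + α)))

def NN (α : ℕ) (p : ℕ × ℕ × ℕ) : ℕ := p.1 + p.2.1 + (2 * p.2.2 + α)

def rr (α : ℕ) (μ ν s : ℝ) (p : ℕ × ℕ × ℕ) : ℝ :=
  cc α μ ν s p * ((1 / 4) ^ (NN α p + 1) / ((NN α p + 1).factorial : ℝ))

theorem fiber (α : ℕ) (μ ν s : ℝ) (hs : s ^ 2 = μ * ν) (a b : ℕ) :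
    ∑' q : ((fun p : ℕ × ℕ × ℕ => (p.1 + p.2.2, p.2.1 + p.2.2)) ⁻¹' {(a, b)}), rr α μ ν s q
     = s ^ α * (1 / 4) ^ (α + 1) * (uu α μ a * uu α ν b / (a + b + α + 1)) := by
  have hset : ((fun p : ℕ × ℕ × ℕ => (p.1 + p.2.2, p.2.1 + p.2.2)) ⁻¹' {(a, b)}) =
      ((((Finset.range (b + 1)).filter (fun k => k ≤ a)).image (fun k => (a - k, b - k, k)) : Finset (ℕ × ℕ × ℕ)) : Set (ℕ × ℕ × ℕ)) := by
    ext ⟨i, j, k⟩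
    simp only [Set.mem_preimage, Set.mem_singleton_iff, Prod.mk.injEq, Finset.coe_image, Set.mem_image,
      Finset.mem_coe, Finset.mem_filter, Finset.mem_range]
    constructor
    · rintro ⟨h1, h2⟩
      exact ⟨k, by omega, by omega, by omega, rfl⟩
    · rintro ⟨k', h1, h2, h3, h4⟩
      omega
  rw [hset, Finset.tsum_subtype' _ (rr α μ ν s), Finset.sum_image (by
    intro x _ y _ h
    simp only [Prod.mk.injEq] at h
    exact h.2.2)]
  have hf : ∀ n : ℕ, (n.factorial : ℝ) ≠ 0 := fun n => by exact_mod_cast (Nat.factorial_ne_zero n)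
  have e : ∀ k ∈ (Finset.range (b + 1)).filter (fun k => k ≤ a), rr α μ ν s (a - k, b - k, k) =
      (s ^ α * (-μ) ^ a * (-ν) ^ b * ((1 / 4) ^ (a + b + α + 1) / ((a + b + α + 1).factorial : ℝ))) *
      ((1:ℝ) / (((a - k).factorial : ℝ) * ((b - k).factorial : ℝ) * (k.factorial : ℝ) * ((k + α).factorial : ℝ))) := by
    intro k hk
    simp only [Finset.mem_filter, Finset.mem_range] at hk
    obtain ⟨i, rfl⟩ := Nat.exists_eq_add_of_le hk.2
    obtain ⟨j, rfl⟩ := Nat.exists_eq_add_of_le (by omega : k ≤ b)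
    have hN : NN α (k + i - k, k + j - k, k) = k + i + (k + j) + α := by
      unfold NN; dsimp only; omega
    unfold rr
    rw [hN]
    unfold cc
    dsimp only
    rw [Nat.add_sub_cancel_left, Nat.add_sub_cancel_left]
    have h1 := hf i
    have h2 := hf j
    have h3 := hf k
    have h4 := hf (k + α)
    have h5 := hf (k + i + (k + j) + α + 1)
    have hp : s ^ (2 * k + α) = s ^ α * ((-μ) ^ k * (-ν) ^ k) := by
      rw [pow_add, pow_mul, hs, ← mul_pow, neg_mul_neg, mul_comm]
    rw [hp, pow_add (-μ), pow_add (-ν)]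
    field_simp
  rw [Finset.sum_congr rfl e, ← Finset.mul_sum, vand]
  unfold uu
  rw [Nat.factorial_succ]
  push_cast
  have h1 := hf a
  have h2 := hf b
  have h3 := hf (a + α)
  have h4 := hf (b + α)
  have h5 := hf (a + b + α)
  have h6 : (a + b + α + 1 : ℝ) ≠ 0 := by positivity
  have e4 : (1 / 4 : ℝ) ^ (a + b + α + 1) = (1 / 4) ^ a * (1 / 4) ^ b * (1 / 4) ^ (α + 1) := by
    rw [← pow_add, ← pow_add, ← add_assoc]
  rw [e4, show -μ / 4 = -μ * (1 / 4) by ring, show -ν / 4 = -ν * (1 / 4) by ring, mul_pow, mul_pow]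
  generalize (1 / 4 : ℝ) ^ a = A
  generalize (1 / 4 : ℝ) ^ b = B
  generalize (1 / 4 : ℝ) ^ (α + 1) = C
  generalize (-μ) ^ a = D
  generalize (-ν) ^ b = E
  field_simp

theorem real_sum (α : ℕ) (μ ν s R : ℝ) (hs : s ^ 2 = μ * ν) (h : HasSum (rr α μ ν s) R) :
    R = s ^ α * (1 / 4) ^ (α + 1) * ∑' p : ℕ × ℕ, uu α μ p.1 * uu α ν p.2 / (p.1 + p.2 + α + 1) := by
  have h1 := h.tsum_fiberwise (fun p : ℕ × ℕ × ℕ => (p.1 + p.2.2, p.2.1 + p.2.2))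
  refine h1.unique ?_
  refine ((summable_T α μ ν).hasSum.mul_left (s ^ α * (1 / 4) ^ (α + 1))).congr_fun ?_
  rintro ⟨a, b⟩
  exact fiber α μ ν s hs a b

theorem hasSum_prod_mulC {ι κ : Type} (f : ι → ℂ) (g : κ → ℂ) (F G : ℂ) (hf : Summable fun a => ‖f a‖)
    (hg : Summable fun a => ‖g a‖) (hF : HasSum f F) (hG : HasSum g G) :
    HasSum (fun p : ι × κ => f p.1 * g p.2) (F * G) ∧ Summable (fun p : ι × κ => ‖f p.1 * g p.2‖) := by
  have hs : Summable (fun p : ι × κ => f p.1 * g p.2) := summable_mul_of_summable_norm hf hg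
  exact ⟨hF.mul hG hs, hs.norm⟩

theorem exp_sumC (w : ℂ) : HasSum (fun n : ℕ => w ^ n / (n.factorial : ℂ)) (Complex.exp w) ∧
    Summable (fun n : ℕ => ‖w ^ n / (n.factorial : ℂ)‖) := by
  refine ⟨?_, ?_⟩
  · rw [Complex.exp_eq_exp_ℂ]
    exact NormedSpace.expSeries_div_hasSum_exp w
  · exact NormedSpace.norm_expSeries_div_summable w

theorem besselI_sum (α : ℕ) (z : ℂ) :
    HasSum (fun k : ℕ => 1 / ((k.factorial : ℂ) * ((k + α).factorial : ℂ)) * (z / 2) ^ (2 * k + α)) (besselI α z) ∧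
    Summable (fun k : ℕ => ‖1 / ((k.factorial : ℂ) * ((k + α).factorial : ℂ)) * (z / 2) ^ (2 * k + α)‖) := by
  have h : Summable (fun k : ℕ => ‖1 / ((k.factorial : ℂ) * ((k + α).factorial : ℂ)) * (z / 2) ^ (2 * k + α)‖) := by
    refine Summable.of_nonneg_of_le (fun _ => norm_nonneg _) (fun k => ?_)
      ((Real.summable_pow_div_factorial (‖z / 2‖ ^ 2)).mul_left (‖z / 2‖ ^ α))
    rw [norm_mul, norm_div, norm_mul, norm_one, norm_pow, Complex.norm_natCast, Complex.norm_natCast,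
      pow_add, pow_mul]
    have := mul_le_mul_of_nonneg_left (coef_bound' α k)
      (by positivity : 0 ≤ ‖z / 2‖ ^ α * (‖z / 2‖ ^ 2) ^ k)
    refine le_trans (le_of_eq ?_) (this.trans (le_of_eq ?_)) <;> ring
  exact ⟨h.of_norm.hasSum, h⟩

theorem expansion (α : ℕ) (μ ν s : ℝ) (z : ℂ) :
    HasSum (fun p : ℕ × ℕ × ℕ => (cc α μ ν s p : ℂ) / z ^ (NN α p))
      (Complex.exp (-((μ : ℂ) + ν) / z) * besselI α (2 * s / z)) ∧
    Summable (fun p : ℕ × ℕ × ℕ => ‖(cc α μ ν s p : ℂ) / z ^ (NN α p)‖) := by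
  have h1 := exp_sumC (-(μ:ℂ) / z)
  have h2 := exp_sumC (-(ν:ℂ) / z)
  have h3 := besselI_sum α (2 * s / z)
  have h4 := hasSum_prod_mulC _ _ _ _ h2.2 h3.2 h2.1 h3.1
  have h5 := hasSum_prod_mulC _ _ _ _ h1.2 h4.2 h1.1 h4.1
  have e : ∀ p : ℕ × ℕ × ℕ, (cc α μ ν s p : ℂ) / z ^ (NN α p) =
     (-(μ:ℂ) / z) ^ p.1 / (p.1.factorial : ℂ) * ((-(ν:ℂ) / z) ^ p.2.1 / (p.2.1.factorial : ℂ) *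
      (1 / ((p.2.2.factorial : ℂ) * ((p.2.2 + α).factorial : ℂ)) * (2 * s / z / 2) ^ (2 * p.2.2 + α))) := by
    rintro ⟨i, j, k⟩
    unfold cc NN
    dsimp only
    rw [show 2 * (s:ℂ) / z / 2 = s / z by ring]
    push_cast
    rw [div_pow, div_pow, div_pow, pow_add z, pow_add z]
    ring
  simp_rw [e]
  refine ⟨?_, h5.2⟩
  rw [show -((μ : ℂ) + ν) / z = -(μ:ℂ) / z + -(ν:ℂ) / z by ring, Complex.exp_add, mul_assoc]
  exact h5.1

theorem integral_sum (α : ℕ) (μ ν s : ℝ) :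
    HasSum (fun p => ((2 * Real.pi : ℝ) : ℂ) * (rr α μ ν s p : ℂ)) (∫ t : ℝ,
      Complex.exp ((1 + (t : ℂ) * Complex.I) / 4
              - ((μ : ℂ) + (ν : ℂ)) / (1 + (t : ℂ) * Complex.I)) *
            besselI α (2 * s / (1 + (t : ℂ) * Complex.I)) /
              (1 + (t : ℂ) * Complex.I) ^ 2) := by
  have hcs : Summable (fun p => ‖cc α μ ν s p‖) := by
    have := (expansion α μ ν s 1).2
    simpa using this
  set F : ℕ × ℕ × ℕ → ℝ → ℂ := fun p t => (cc α μ ν s p : ℂ) *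
    (Complex.exp ((1 + (t : ℂ) * Complex.I) / 4) / (1 + (t : ℂ) * Complex.I) ^ (NN α p + 2)) with hF
  have hFn : ∀ p t, ‖F p t‖ ≤ ‖cc α μ ν s p‖ * (Real.exp (1/4) * (1 + t ^ 2)⁻¹) := by
    intro p t
    rw [hF]
    dsimp only
    rw [norm_mul, Complex.norm_real, div_eq_mul_one_div, norm_mul, Complex.norm_exp]
    have h1 := norm_inv_z_le (NN α p) t
    have h2 : ((1 + (t:ℂ) * Complex.I) / 4).re = 1 / 4 := by
      simp
    rw [h2]
    gcongr
  have hgi : ∀ p, Integrable (fun t : ℝ => ‖cc α μ ν s p‖ * (Real.exp (1/4) * (1 + t ^ 2)⁻¹)) :=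
    fun p => (integrable_inv_one_add_sq.const_mul _).const_mul _
  have hFi : ∀ p, Integrable (F p) := by
    intro p
    refine Integrable.mono' (hgi p) ?_ (Filter.Eventually.of_forall (hFn p))
    refine Continuous.aestronglyMeasurable ?_
    refine continuous_const.mul (Continuous.div (by fun_prop) (by fun_prop) (fun t => pow_ne_zero _ (z_ne t)))
  have hsum : Summable fun p => ∫ t, ‖F p t‖ := by
    refine Summable.of_nonneg_of_le (fun p => integral_nonneg fun t => norm_nonneg _) (fun p => ?_)
      (hcs.mul_right (∫ t : ℝ, Real.exp (1/4) * (1 + t ^ 2)⁻¹))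
    rw [← integral_const_mul]
    exact integral_mono (hFi p).norm (hgi p) (hFn p)
  have key := hasSum_integral_of_summable_integral_norm hFi hsum
  have e1 : ∀ t : ℝ, ∑' p, F p t = Complex.exp ((1 + (t : ℂ) * Complex.I) / 4
              - ((μ : ℂ) + (ν : ℂ)) / (1 + (t : ℂ) * Complex.I)) *
            besselI α (2 * s / (1 + (t : ℂ) * Complex.I)) /
              (1 + (t : ℂ) * Complex.I) ^ 2 := by
    intro t
    have h := ((expansion α μ ν s (1 + (t:ℂ) * Complex.I)).1.mul_left
      (Complex.exp ((1 + (t : ℂ) * Complex.I) / 4) / (1 + (t : ℂ) * Complex.I) ^ 2))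
    have h' : HasSum (fun p => F p t) _ := h.congr_fun (fun p => by
      rw [hF]
      dsimp only
      rw [pow_add]
      generalize 1 + (t:ℂ) * Complex.I = z
      ring)
    rw [h'.tsum_eq, sub_eq_add_neg, Complex.exp_add, neg_div]
    ring
  simp_rw [e1] at key
  refine key.congr_fun fun p => ?_
  rw [hF]
  dsimp only
  rw [integral_const_mul, inv_lap]
  unfold rr
  push_cast
  ring

/-- For `α ∈ ℕ` and `μ, ν > 0` with `μ ≠ ν`, the contour integral over the
vertical line `Re z = 1`, parametrized by `z = 1 + it`, `t : ℝ`, satisfies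
`(1/(2πi)) ∫ exp(z/4 − (μ+ν)/z) I_α(2√(μν)/z)/z² dz
  = (J_α(√μ) √ν J_α'(√ν) − √μ J_α'(√μ) J_α(√ν)) / (2(μ−ν))`. -/
theorem contour_integral_bessel_kernel (α : ℕ) (μ ν : ℝ) (hμ : 0 < μ) (hν : 0 < ν)
    (hμν : μ ≠ ν) :
    (1 / (2 * (Real.pi : ℂ) * Complex.I)) *
        ∫ t : ℝ,
          (Complex.exp ((1 + (t : ℂ) * Complex.I) / 4
              - ((μ : ℂ) + (ν : ℂ)) / (1 + (t : ℂ) * Complex.I)) *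
            besselI α (2 * (Real.sqrt (μ * ν) : ℂ) / (1 + (t : ℂ) * Complex.I)) /
              (1 + (t : ℂ) * Complex.I) ^ 2) * Complex.I
      = (((besselJ α (Real.sqrt μ) * Real.sqrt ν * deriv (besselJ α) (Real.sqrt ν)
          - Real.sqrt μ * deriv (besselJ α) (Real.sqrt μ) * besselJ α (Real.sqrt ν)) /
            (2 * (μ - ν)) : ℝ) : ℂ) := by
  set s := Real.sqrt (μ * ν) with hsdef
  have hs : s ^ 2 = μ * ν := Real.sq_sqrt (by positivity)
  have hs' : s = Real.sqrt μ * Real.sqrt ν := Real.sqrt_mul hμ.le ν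
  have hI := integral_sum α μ ν s
  have hpi : (Real.pi : ℂ) ≠ 0 := by exact_mod_cast Real.pi_ne_zero
  have hrs : Summable (rr α μ ν s) := by
    have h1 := hI.summable
    rw [summable_mul_left_iff (by push_cast; simp [hpi])] at h1
    exact Complex.summable_ofReal.1 h1
  have hval := hI.unique ((Complex.hasSum_ofReal.2 hrs.hasSum).mul_left _)
  rw [integral_mul_const, hval, real_sum α μ ν s _ hs hrs.hasSum]
  have hm := main_series α μ ν
  have hJμ := besselJ_eq α (Real.sqrt μ)
  have hJν := besselJ_eq α (Real.sqrt ν)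
  have hDμ := besselJ_deriv α (Real.sqrt μ) (Real.sqrt_pos.2 hμ)
  have hDν := besselJ_deriv α (Real.sqrt ν) (Real.sqrt_pos.2 hν)
  rw [Real.sq_sqrt hμ.le] at hJμ hDμ
  rw [Real.sq_sqrt hν.le] at hJν hDν
  rw [mul_assoc (besselJ α (Real.sqrt μ)), hDν, hDμ, hJμ, hJν]
  have hsub : μ - ν ≠ 0 := sub_ne_zero.2 hμν
  generalize (∑' p : ℕ × ℕ, uu α μ p.1 * uu α ν p.2 / (p.1 + p.2 + α + 1)) = T at *
  generalize (∑' a, uu α μ a) = P at *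
  generalize (∑' a, uu α ν a) = Q at *
  generalize (∑' a : ℕ, (2 * a + α : ℝ) * uu α μ a) = P' at *
  generalize (∑' a : ℕ, (2 * a + α : ℝ) * uu α ν a) = Q' at *
  have e1 : ∀ X : ℂ, 1 / (2 * (Real.pi : ℂ) * Complex.I) * (((2 * Real.pi : ℝ) : ℂ) * X * Complex.I) = X := by
    intro X
    have := Complex.I_ne_zero
    push_cast
    field_simp
  rw [e1]
  congr 1
  rw [eq_div_iff (by simpa using hsub), hs', mul_pow, div_pow, div_pow, pow_succ, div_pow, one_pow,
    show (4:ℝ) = 2 * 2 by norm_num, mul_pow]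
  linear_combination (2 * (Real.sqrt μ) ^ α * (Real.sqrt ν) ^ α / (2 ^ α * 2 ^ α)) * hm
end
end

section
/- Fix μ, ν ∈ ℂ, b ∈ ℝ, and for each α ∈ ℕ let F_α(z) := exp( −(μ+ν) z/(1−z) + (2b − 3/2) z ) · Σ_{k=0}^{∞} (μν z)^k / ((k+α)! k!) · (1−z)^{−2k−α−2}, an analytic function on the open unit disc, with power series F_α(z) = Σ_{m=0}^{∞} c_α(m) z^m. Then c_α(0) = 1/α!, and for all m ≥ 1: m c_α(m) = (2m+α) c_α(m−1) − (m+α) c_α(m−2) + (2b − 3/2)( c_α(m−1) − 2 c_α(m−2) + c_α(m−3) ) + μν c_{α+1}(m−1) + μν c_{α+1}(m−2) − (μ+ν) c_α(m−1), where c_α(j) := 0 for j < 0. -/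
noncomputable section

lemma aux_congr {f g : ℕ → ℂ} {s t : ℂ} (h : HasSum f s) (hfg : ∀ m, g m = f m) (hst : t = s) :
    HasSum g t := by
  obtain rfl : g = f := funext hfg
  rw [hst]
  exact h

lemma aux_unique (a : ℕ → ℂ) (b : ℕ → ℂ) (f : ℂ → ℂ)
    (ha : ∀ z : ℂ, ‖z‖ < 1 → HasSum (fun m => a m * z ^ m) (f z))
    (hb : ∀ z : ℂ, ‖z‖ < 1 → HasSum (fun m => b m * z ^ m) (f z)) : a = b := by
  have key : ∀ a : ℕ → ℂ, (∀ z : ℂ, ‖z‖ < 1 → HasSum (fun m => a m * z ^ m) (f z)) →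
      HasFPowerSeriesAt f (FormalMultilinearSeries.ofScalars ℂ a) 0 := by
    intro a ha
    rw [hasFPowerSeriesAt_iff]
    filter_upwards [Metric.ball_mem_nhds (0:ℂ) one_pos] with z hz
    have := ha z (by simpa using hz)
    simpa [FormalMultilinearSeries.coeff_ofScalars, mul_comm] using this
  have h := (key a ha).eq_formalMultilinearSeries (key b hb)
  funext n
  have := congrArg (fun p => FormalMultilinearSeries.coeff p n) h
  simpa [FormalMultilinearSeries.coeff_ofScalars] using this

lemma aux_deriv (a : ℕ → ℂ) (f : ℂ → ℂ) (hf : DifferentiableOn ℂ f (Metric.ball 0 1))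
    (ha : ∀ z : ℂ, ‖z‖ < 1 → HasSum (fun m => a m * z ^ m) (f z)) (z : ℂ) (hz : ‖z‖ < 1) :
    HasSum (fun m : ℕ => ((m : ℂ) + 1) * a (m + 1) * z ^ m) (deriv f z) := by
  have e := aux_unique a (fun n => (n.factorial : ℂ)⁻¹ * iteratedDeriv n f 0) f ha (by
    intro z hz
    have := Complex.hasSum_taylorSeries_on_ball (f := f) (c := 0) (r := 1) (z := z)
      (by simpa using hf) (by simpa using hz)
    refine this.congr_fun ?_ |> id
    intro n
    simp; ring)
  have := Complex.hasSum_taylorSeries_on_ball (f := deriv f) (c := 0) (r := 1) (z := z)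
      (by simpa using hf.deriv Metric.isOpen_ball) (by simpa using hz)
  refine aux_congr this (fun n => ?_) rfl
  rw [e]
  beta_reduce
  rw [iteratedDeriv_succ']
  have : (n.factorial : ℂ) ≠ 0 := by exact_mod_cast n.factorial_ne_zero
  have h2 : (n : ℂ) + 1 ≠ 0 := by exact_mod_cast n.succ_ne_zero
  simp [Nat.factorial_succ]
  field_simp

lemma aux_shift (g : ℤ → ℂ) (hg : ∀ j < 0, g j = 0) (z s : ℂ)
    (h : HasSum (fun m : ℕ => g (m : ℤ) * z ^ m) s) :
    HasSum (fun m : ℕ => g ((m : ℤ) - 1) * z ^ m) (z * s) := by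
  rw [← hasSum_nat_add_iff' 1]
  have := h.mul_left z
  simp only [Finset.range_one, Finset.sum_singleton]
  rw [hg _ (by norm_num)]
  simp only [zero_mul, sub_zero]
  refine aux_congr this (fun m => ?_) rfl
  push_cast
  rw [add_sub_cancel_right]
  ring

def auxB (α : ℕ) (w : ℂ) : ℂ := ∑' k : ℕ, w ^ k / (((k + α).factorial : ℂ) * (k.factorial : ℂ))

lemma auxB_bound (α k : ℕ) (w : ℂ) :
    ‖w ^ k / (((k + α).factorial : ℂ) * (k.factorial : ℂ))‖ ≤ ‖w‖ ^ k / k.factorial := by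
  rw [norm_div, norm_mul, norm_pow]
  simp only [Complex.norm_natCast]
  have h1 : (1:ℝ) ≤ (k + α).factorial := by exact_mod_cast Nat.factorial_pos _
  have h2 : (0:ℝ) < k.factorial := by exact_mod_cast Nat.factorial_pos _
  gcongr
  nlinarith

lemma auxB_summable (α : ℕ) (w : ℂ) :
    Summable (fun k : ℕ => w ^ k / (((k + α).factorial : ℂ) * (k.factorial : ℂ))) :=
  Summable.of_norm_bounded (Real.summable_pow_div_factorial ‖w‖) (fun k => auxB_bound α k w)

lemma auxB_succ_term (α k : ℕ) (w : ℂ) :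
    (((k + 1 : ℕ) : ℂ) * w ^ (k + 1 - 1)) / (((k + 1 + α).factorial : ℂ) * ((k + 1).factorial : ℂ))
      = w ^ k / (((k + (α + 1)).factorial : ℂ) * (k.factorial : ℂ)) := by
  have e : k + 1 + α = k + (α + 1) := by ring
  rw [e]
  have h2 : (n : ℕ) → (n.factorial : ℂ) ≠ 0 := fun n => by exact_mod_cast n.factorial_ne_zero
  have h3 : (k : ℂ) + 1 ≠ 0 := by exact_mod_cast k.succ_ne_zero
  have := h2 (k + (α + 1))
  have := h2 k
  rw [Nat.factorial_succ k]
  push_cast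
  field_simp

lemma auxB_deriv (α : ℕ) (w : ℂ) : HasDerivAt (auxB α) (auxB (α + 1) w) w := by
  set R := ‖w‖ + 1
  have hw : w ∈ Metric.ball (0:ℂ) R := by simp [R]
  have h := hasDerivAt_tsum_of_isPreconnected (𝕜 := ℂ)
    (g := fun (k : ℕ) (w : ℂ) => w ^ k / (((k + α).factorial : ℂ) * (k.factorial : ℂ)))
    (g' := fun (k : ℕ) (w : ℂ) =>
      ((k : ℂ) * w ^ (k - 1)) / (((k + α).factorial : ℂ) * (k.factorial : ℂ)))
    (u := fun k : ℕ => if k = 0 then 0 else R ^ (k - 1) / (k - 1).factorial)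
    (t := Metric.ball 0 R) (y₀ := w) (y := w) ?_ Metric.isOpen_ball
    (convex_ball _ _).isPreconnected ?_ ?_ hw (auxB_summable α w) hw
  · unfold auxB
    refine HasDerivAt.congr_deriv h ?_
    rw [tsum_eq_zero_add']
    · simp only [auxB_succ_term]; simp
    · simp only [auxB_succ_term]
      exact auxB_summable (α + 1) w
  · rw [← summable_nat_add_iff 1]
    simpa using Real.summable_pow_div_factorial R
  · intro k y _
    exact (hasDerivAt_pow k y).div_const _
  · intro k y hy
    rcases k with _ | k
    · simp
    · rw [auxB_succ_term]
      refine (auxB_bound _ _ _).trans ?_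
      have : ‖y‖ ≤ R := by simpa using (Metric.mem_ball.1 hy).le
      simp
      gcongr

def auxF (μ ν β : ℂ) (α : ℕ) (z : ℂ) : ℂ :=
  Complex.exp (-(μ + ν) * (z / (1 - z)) + β * z) *
    (auxB α (μ * ν * z / (1 - z) ^ 2) / (1 - z) ^ (α + 2))

lemma auxF_eq (μ ν β : ℂ) (α : ℕ) (z : ℂ) (hz : 1 - z ≠ 0) :
    Complex.exp (-(μ + ν) * (z / (1 - z)) + β * z) *
          ∑' k : ℕ, (μ * ν * z) ^ k / (((k + α).factorial : ℂ) * (k.factorial : ℂ)) *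
            (1 - z) ^ (-(2 * (k : ℤ)) - (α : ℤ) - 2) = auxF μ ν β α z := by
  unfold auxF auxB
  rw [← tsum_div_const]
  congr 2
  funext k
  have : -(2 * (k : ℤ)) - (α : ℤ) - 2 = -((2 * k + (α + 2) : ℕ) : ℤ) := by push_cast; ring
  rw [this, zpow_neg, zpow_natCast, pow_add, pow_mul, div_pow]
  field_simp

lemma auxF_deriv (μ ν β : ℂ) (α : ℕ) (z : ℂ) (hz : 1 - z ≠ 0) :
    HasDerivAt (auxF μ ν β α)
      ((-(μ + ν) / (1 - z) ^ 2 + β + (α + 2) / (1 - z)) * auxF μ ν β α z +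
        μ * ν * (1 + z) / (1 - z) ^ 2 * auxF μ ν β (α + 1) z) z := by
  have h1 : HasDerivAt (fun z : ℂ => 1 - z) (-1) z := by
    simpa using (hasDerivAt_id z).const_sub 1
  have h2 := (((hasDerivAt_id z).div h1 hz).const_mul (-(μ + ν))).add
    ((hasDerivAt_id z).const_mul β)
  have hw := ((hasDerivAt_id z).const_mul (μ * ν)).div (h1.pow 2) (pow_ne_zero 2 hz)
  have hB := (auxB_deriv α _).comp z hw
  have := h2.cexp.mul (hB.div (h1.pow (α + 2)) (pow_ne_zero _ hz))
  refine this.congr_deriv ?_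
  simp only [auxF, id, Function.comp, Pi.pow_apply, Pi.div_apply, Pi.add_apply, Pi.mul_apply]
  generalize auxB α _ = X
  generalize auxB (α + 1) _ = Y
  generalize Complex.exp _ = E
  simp only [Nat.add_sub_cancel, pow_succ, show α + 2 - 1 = α + 1 from rfl]
  push_cast
  field_simp
  ring

/-- Let `F_α(z) = exp(−(μ+ν)z/(1−z) + (2b−3/2)z) ·
∑_k (μν z)^k/((k+α)! k!) (1−z)^(−2k−α−2)` on the open unit disc, with power series
coefficients `c_α(m)` (and `c_α(j) = 0` for `j < 0`).  Then `c_α(0) = 1/α!` and, for `m ≥ 1`,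
`m c_α(m) = (2m+α) c_α(m−1) − (m+α) c_α(m−2)
  + (2b−3/2)(c_α(m−1) − 2c_α(m−2) + c_α(m−3))
  + μν c_{α+1}(m−1) + μν c_{α+1}(m−2) − (μ+ν) c_α(m−1)`. -/
theorem coefficient_recursion (μ ν : ℂ) (b : ℝ) (c : ℕ → ℤ → ℂ)
    (hcneg : ∀ (α : ℕ) (j : ℤ), j < 0 → c α j = 0)
    (hc : ∀ (α : ℕ) (z : ℂ), ‖z‖ < 1 →
      HasSum (fun m : ℕ => c α (m : ℤ) * z ^ m)
        (Complex.exp (-(μ + ν) * (z / (1 - z)) + (2 * (b : ℂ) - 3 / 2) * z) *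
          ∑' k : ℕ, (μ * ν * z) ^ k / (((k + α).factorial : ℂ) * (k.factorial : ℂ)) *
            (1 - z) ^ (-(2 * (k : ℤ)) - (α : ℤ) - 2))) :
    (∀ α : ℕ, c α 0 = 1 / (α.factorial : ℂ)) ∧
    (∀ (α : ℕ) (m : ℕ), 1 ≤ m →
      (m : ℂ) * c α (m : ℤ)
        = (2 * (m : ℂ) + (α : ℂ)) * c α ((m : ℤ) - 1)
          - ((m : ℂ) + (α : ℂ)) * c α ((m : ℤ) - 2)
          + (2 * (b : ℂ) - 3 / 2) *
              (c α ((m : ℤ) - 1) - 2 * c α ((m : ℤ) - 2) + c α ((m : ℤ) - 3))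
          + μ * ν * c (α + 1) ((m : ℤ) - 1)
          + μ * ν * c (α + 1) ((m : ℤ) - 2)
          - (μ + ν) * c α ((m : ℤ) - 1)) := by
  set β : ℂ := 2 * (b : ℂ) - 3 / 2 with hβ
  have hne : ∀ z : ℂ, ‖z‖ < 1 → 1 - z ≠ 0 := by
    intro z hz h
    rw [sub_eq_zero] at h
    rw [← h] at hz
    simp at hz
  have hF : ∀ (α : ℕ) (z : ℂ), ‖z‖ < 1 →
      HasSum (fun m : ℕ => c α (m : ℤ) * z ^ m) (auxF μ ν β α z) := by
    intro α z hz
    rw [← auxF_eq μ ν β α z (hne z hz)]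
    exact hc α z hz
  refine ⟨?_, ?_⟩
  · intro α
    have h0 := hF α 0 (by simp)
    have h1 := hasSum_single (f := fun m : ℕ => c α (m : ℤ) * (0:ℂ) ^ m) 0
      (by intro m hm; simp [hm])
    have := h1.unique h0
    simp only [auxF, auxB] at this
    rw [tsum_eq_single 0 (by intro m hm; simp [hm])] at this
    simpa using this
  · intro α m hm
    obtain ⟨n, rfl⟩ : ∃ n, m = n + 1 := ⟨m - 1, by omega⟩
    have hd : DifferentiableOn ℂ (auxF μ ν β α) (Metric.ball 0 1) := fun z hz =>
      (auxF_deriv μ ν β α z (hne z (by simpa using hz))).differentiableAt.differentiableWithinAt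
    have hs1 : ∀ (g : ℤ → ℂ) (j : ℤ), (∀ j < 0, g j = 0) → 0 ≤ j → ∀ i < 0, g (i - j) = 0 :=
      fun g j hg hj i hi => hg _ (by omega)
    set d : ℤ → ℂ := fun j => ((j : ℂ) + 1) * c α (j + 1) with hdd
    have hdneg : ∀ j < 0, d j = 0 := by
      intro j hj
      rcases eq_or_lt_of_le (show j ≤ -1 by omega) with h | h
      · simp [hdd, h]
      · simp only [hdd]; rw [hcneg α _ (by omega), mul_zero]
    have key := aux_unique
      (fun n : ℕ => d n - 2 * d ((n : ℤ) - 1) + d ((n : ℤ) - 1 - 1))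
      (fun n : ℕ => -(μ + ν) * c α n + β * (c α n - 2 * c α ((n : ℤ) - 1) + c α ((n : ℤ) - 1 - 1))
        + (α + 2) * (c α n - c α ((n : ℤ) - 1))
        + μ * ν * (c (α + 1) n + c (α + 1) ((n : ℤ) - 1)))
      (fun z => (1 - z) ^ 2 * deriv (auxF μ ν β α) z) ?_ ?_
    · have := congrFun key n
      simp only [hdd] at this
      push_cast at this ⊢
      have e1 : (n : ℤ) + 1 - 1 = n := by ring
      have e2 : (n : ℤ) - 1 + 1 = n := by ring
      have e3 : (n : ℤ) - 1 - 1 + 1 = n - 1 := by ring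
      have e4 : (n : ℤ) + 1 - 2 = n - 1 := by ring
      have e5 : (n : ℤ) + 1 - 3 = n - 1 - 1 := by ring
      rw [e2, e3] at this
      rw [e1, e4, e5]
      linear_combination this
    · intro z hz
      have h0 : HasSum (fun m : ℕ => d m * z ^ m) (deriv (auxF μ ν β α) z) := by
        have := aux_deriv (fun m : ℕ => c α m) _ hd (hF α) z hz
        simpa [hdd] using this
      have h1 := aux_shift d hdneg z _ h0
      have h2 := aux_shift (fun j => d (j - 1)) (hs1 d 1 hdneg (by norm_num)) z _ h1
      have := (h0.sub (h1.mul_left 2)).add h2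
      refine aux_congr this (fun m => ?_) ?_
      · ring
      · ring
    · intro z hz
      have h0 := hF α z hz
      have h1 := aux_shift (c α) (hcneg α) z _ h0
      have h2 := aux_shift (fun j => c α (j - 1)) (hs1 _ 1 (hcneg α) (by norm_num)) z _ h1
      have k0 := hF (α + 1) z hz
      have k1 := aux_shift (c (α + 1)) (hcneg (α + 1)) z _ k0
      have := (((h0.mul_left (-(μ + ν))).add (((h0.sub (h1.mul_left 2)).add h2).mul_left β)).add
        ((h0.sub h1).mul_left ((α : ℂ) + 2))).add ((k0.add k1).mul_left (μ * ν))
      refine aux_congr this (fun m => ?_) ?_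
      · ring
      · rw [(auxF_deriv μ ν β α z (hne z hz)).deriv]
        have := hne z hz
        field_simp
        ring
end
end
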